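/- arXiv:2105.03107 — 2 statements merged into one kernel-verified Lean document; each statement's English description precedes it below -/
import Mathlib

section
/- Let (M_n) be a nonnegative martingale with M_0 = 1 satisfying the product-structure condition (2.1). Assume P(M_∞ > 0) > 0 and that there exists K > 1 with P(M_{n+1} ≤ K·M_n) = 1 for all n ∈ ℕ. Then there exists p > 1 such that sup_{n∈ℕ} E[M_n^p]^{1/p} < ∞. -/
open MeasureTheory ProbabilityTheory Filter Topology

lemma aux_key {Ω : Type*} {m m0 : MeasurableSpace Ω} {μ : Measure Ω} [IsProbabilityMeasure μ]
    (hm : m ≤ m0) {g W X : Ω → ℝ} {c : ℝ}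
    (h : ∀ᵐ ω ∂μ, 0 < X ω → (μ[g | m]) ω ≤ c) (hg : Integrable g μ)
    (hW : StronglyMeasurable[m] W) (hWi : Integrable W μ) (hWg : Integrable (W * g) μ)
    (hW0 : ∀ᵐ ω ∂μ, 0 ≤ W ω) (hWX : ∀ᵐ ω ∂μ, W ω ≠ 0 → 0 < X ω) :
    ∫ ω, W ω * g ω ∂μ ≤ (∫ ω, W ω ∂μ) * c := by
  have h1 : μ[W * g | m] =ᵐ[μ] W * μ[g | m] :=
    condExp_mul_of_stronglyMeasurable_left hW hWg hg
  have h2 : ∫ ω, W ω * g ω ∂μ = ∫ ω, (μ[W * g | m]) ω ∂μ := by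
    rw [integral_condExp hm]; rfl
  rw [h2, ← integral_mul_const]
  refine integral_mono_ae integrable_condExp (hWi.mul_const c) ?_
  filter_upwards [h1, h, hW0, hWX] with ω a1 a2 a3 a4
  rw [a1]
  by_cases hw : W ω = 0
  · simp [hw]
  · exact mul_le_mul_of_nonneg_left (a2 (a4 hw)) a3

lemma aux_convex : ConvexOn ℝ (Set.Ici 0) (fun x : ℝ => -min x 1) := by
  apply ConcaveOn.neg
  exact (concaveOn_id (convex_Ici 0)).inf (concaveOn_const 1 (convex_Ici 0))

/-- first passage events -/
def auxT {Ω : Type*} (M : ℕ → Ω → ℝ) (t : ℝ) (k : ℕ) : Set Ω :=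
  {ω | t ≤ M k ω ∧ ∀ j < k, M j ω < t}

lemma auxT_meas {Ω : Type*} {m0 : MeasurableSpace Ω} {ℱ : Filtration ℕ m0} {M : ℕ → Ω → ℝ}
    (hM : ∀ k, StronglyMeasurable[ℱ k] (M k)) (t : ℝ) (k : ℕ) :
    MeasurableSet[ℱ k] (auxT M t k) := by
  have : auxT M t k = {ω | t ≤ M k ω} ∩ ⋂ j, ⋂ (_ : j < k), {ω | M j ω < t} := by
    ext ω; simp [auxT]
  rw [this]
  refine MeasurableSet.inter ?_ ?_
  · exact (hM k).measurable measurableSet_Ici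
  · refine MeasurableSet.iInter fun j => MeasurableSet.iInter fun hj => ?_
    exact ℱ.mono hj.le _
      ((hM j).measurable measurableSet_Iio)

lemma auxT_sum_le {Ω : Type*} (M : ℕ → Ω → ℝ) (t : ℝ) (n : ℕ) (ω : Ω) (x : ℝ) (hx : 0 ≤ x) :
    ∑ k ∈ Finset.range n, (auxT M t k).indicator (fun _ => x) ω
      ≤ {ω | ∃ k, t ≤ M k ω}.indicator (fun _ => x) ω := by
  by_cases h : ∃ k ∈ Finset.range n, ω ∈ auxT M t k
  · obtain ⟨k, hk, hkT⟩ := h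
    rw [Finset.sum_eq_single_of_mem k hk]
    · rw [Set.indicator_of_mem hkT, Set.indicator_of_mem]
      exact ⟨k, hkT.1⟩
    · intro j _ hj
      apply Set.indicator_of_notMem
      intro hjT
      rcases lt_or_gt_of_ne hj with h | h
      · exact absurd hjT.1 (not_le.2 (hkT.2 j h))
      · exact absurd hkT.1 (not_le.2 (hjT.2 k h))
  · push Not at h
    rw [Finset.sum_eq_zero]
    · exact Set.indicator_nonneg (fun _ _ => hx) _
    · intro k hk
      exact Set.indicator_of_notMem (h k hk) _

lemma auxT_cover {Ω : Type*} (M : ℕ → Ω → ℝ) (t : ℝ) (n : ℕ) (ω : Ω) (h : t ≤ M n ω) :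
    ∃ k ∈ Finset.range (n + 1), ω ∈ auxT M t k := by
  classical
  have hex : ∃ k, t ≤ M k ω := ⟨n, h⟩
  refine ⟨Nat.find hex, ?_, Nat.find_spec hex, fun j hj => not_le.1 (Nat.find_min hex hj)⟩
  exact Finset.mem_range.2 (Nat.lt_succ_of_le (Nat.find_min' hex h))

theorem nonneg_martingale_prod_structure_Lp_bounded
    {Ω : Type*} {m0 : MeasurableSpace Ω} {μ : Measure Ω} [IsProbabilityMeasure μ]
    {ℱ : Filtration ℕ m0} {M : ℕ → Ω → ℝ}
    (hmart : Martingale M ℱ μ)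
    (hnonneg : ∀ n, 0 ≤ᵐ[μ] M n)
    (hone : M 0 =ᵐ[μ] fun _ => 1)
    {Minf : Ω → ℝ} (hMinf : Measurable Minf)
    (hconv : ∀ᵐ ω ∂μ, Tendsto (fun n => M n ω) atTop (𝓝 (Minf ω)))
    (hprod : ∀ k l : ℕ, ∀ f : ℝ → ℝ, ConvexOn ℝ (Set.Ici 0) f →
      Integrable (fun ω => f (M l ω)) μ →
      Integrable (fun ω => f (M (k + l) ω / M k ω)) μ →
      ∀ᵐ ω ∂μ, 0 < M k ω →
        (μ[fun ω' => f (M (k + l) ω' / M k ω') | ℱ k]) ω ≤ ∫ ω', f (M l ω') ∂μ)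
    (hwd : 0 < μ {ω | 0 < Minf ω})
    {K : ℝ} (hK : 1 < K)
    (hbdd : ∀ n : ℕ, ∀ᵐ ω ∂μ, M (n + 1) ω ≤ K * M n ω) :
    ∃ p : ℝ, 1 < p ∧ (⨆ n, ∫⁻ ω, ENNReal.ofReal (M n ω ^ p) ∂μ) < ⊤ := by
  have hK0 : 0 < K := by linarith
  have hsm : ∀ k, StronglyMeasurable[ℱ k] (M k) := fun k => hmart.1 k
  have hmeas : ∀ k, Measurable (M k) := fun k => ((hsm k).mono (ℱ.le k)).measurable
  have hTm : ∀ t k, MeasurableSet[ℱ k] (auxT M t k) := fun t k => auxT_meas hsm t k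
  have hTm' : ∀ t k, MeasurableSet (auxT M t k) := fun t k => ℱ.le k _ (hTm t k)
  have hnn : ∀ᵐ ω ∂μ, ∀ n, 0 ≤ M n ω := ae_all_iff.2 hnonneg
  have hbd : ∀ᵐ ω ∂μ, ∀ n, M (n + 1) ω ≤ K * M n ω := ae_all_iff.2 hbdd
  have hmul : ∀ᵐ ω ∂μ, ∀ k l, M (k + l) ω ≤ K ^ l * M k ω := by
    filter_upwards [hbd] with ω h k l
    induction l with
    | zero => simp
    | succ l ih =>
      calc M (k + (l + 1)) ω ≤ K * M (k + l) ω := h (k + l)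
        _ ≤ K * (K ^ l * M k ω) := by gcongr
        _ = _ := by ring
  have hpow : ∀ᵐ ω ∂μ, ∀ n, M n ω ≤ K ^ n := by
    filter_upwards [hmul, hone] with ω h h1 n
    have := h 0 n
    rw [h1] at this
    simpa using this
  have hinf0 : ∀ᵐ ω ∂μ, 0 ≤ Minf ω := by
    filter_upwards [hnn, hconv] with ω h h1
    exact ge_of_tendsto' h1 h
  -- integrability of the limit (Fatou)
  have hinfint : Integrable Minf μ := by
    refine ⟨hMinf.aestronglyMeasurable, ?_⟩
    rw [hasFiniteIntegral_iff_ofReal hinf0]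
    have hL : ∀ n, ∫⁻ ω, ENNReal.ofReal (M n ω) ∂μ = ENNReal.ofReal (∫ ω, M 0 ω ∂μ) := by
      intro n
      rw [← ofReal_integral_eq_lintegral_ofReal (hmart.integrable n) (hnonneg n)]
      congr 1
      have := hmart.setIntegral_eq (Nat.zero_le n) (MeasurableSet.univ (α := Ω))
      simpa using this.symm
    have : ∫⁻ ω, ENNReal.ofReal (Minf ω) ∂μ
        ≤ liminf (fun n => ∫⁻ ω, ENNReal.ofReal (M n ω) ∂μ) atTop := by
      refine le_trans (le_of_eq ?_) (lintegral_liminf_le fun n => (hmeas n).ennreal_ofReal)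
      refine lintegral_congr_ae ?_
      filter_upwards [hconv] with ω h
      exact ((ENNReal.continuous_ofReal.tendsto _).comp h).liminf_eq.symm
    refine this.trans_lt ?_
    simp [hL]
  -- the constant c
  set c : ℝ := ∫ ω, min (Minf ω) 1 ∂μ with hc
  have hcint : Integrable (fun ω => min (Minf ω) 1) μ := hinfint.inf (integrable_const 1)
  have hcpos : 0 < c := by
    rw [hc, integral_pos_iff_support_of_nonneg_ae]
    · refine hwd.trans_le (measure_mono fun ω hω => ?_)
      have : 0 < min (Minf ω) 1 := lt_min hω one_pos
      exact this.ne'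
    · filter_upwards [hinf0] with ω h
      exact le_min h zero_le_one
    · exact hcint
  have hclim : Tendsto (fun l => ∫ ω, min (M l ω) 1 ∂μ) atTop (𝓝 c) := by
    refine tendsto_integral_of_dominated_convergence (fun _ => 1)
      (fun n => ((hmeas n).min measurable_const).aestronglyMeasurable) (integrable_const 1) ?_ ?_
    · intro n
      filter_upwards [hnn] with ω h
      rw [Real.norm_of_nonneg (le_min (h n) zero_le_one)]
      exact min_le_right _ _
    · filter_upwards [hconv] with ω h
      exact h.min tendsto_const_nhds
  have hminint : ∀ l, Integrable (fun ω => min (M l ω) 1) μ := fun l =>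
    (hmart.integrable l).inf (integrable_const 1)
  -- ratio facts
  have hratio : ∀ k l, ∀ᵐ ω ∂μ, 0 ≤ M (k + l) ω / M k ω ∧ M (k + l) ω / M k ω ≤ K ^ l := by
    intro k l
    filter_upwards [hnn, hmul] with ω h h1
    refine ⟨div_nonneg (h _) (h _), ?_⟩
    exact div_le_of_le_mul₀ (h _) (by positivity) (h1 k l)
  have hrmeas : ∀ k l, Measurable (fun ω => M (k + l) ω / M k ω) := fun k l =>
    (hmeas _).div (hmeas _)
  -- lower bound on the limit after first passage
  have hstep : ∀ t : ℝ, 0 < t → ∀ k, t * c * μ.real (auxT M t k)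
      ≤ ∫ ω, (auxT M t k).indicator Minf ω ∂μ := by
    intro t ht k
    set W : Ω → ℝ := (auxT M t k).indicator (M k) with hWdef
    have hW : StronglyMeasurable[ℱ k] W := (hsm k).indicator (hTm t k)
    have hWi : Integrable W μ := (hmart.integrable k).indicator (hTm' t k)
    have hW0 : ∀ᵐ ω ∂μ, 0 ≤ W ω := by
      filter_upwards [hnn] with ω h
      exact Set.indicator_apply_nonneg fun _ => (h k)
    have hWX : ∀ᵐ ω ∂μ, W ω ≠ 0 → 0 < M k ω := by
      refine Eventually.of_forall fun ω hω => ?_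
      have : ω ∈ auxT M t k := Set.mem_of_indicator_ne_zero hω
      exact ht.trans_le this.1
    have hA : ∀ l, (∫ ω, W ω ∂μ) * ∫ ω, min (M l ω) 1 ∂μ
        ≤ ∫ ω, (auxT M t k).indicator (fun ω => min (M (k + l) ω) (M k ω)) ω ∂μ := by
      intro l
      set g : Ω → ℝ := fun ω => -min (M (k + l) ω / M k ω) 1 with hgdef
      have hgm : Measurable g := ((hrmeas k l).min measurable_const).neg
      have hgb : ∀ᵐ ω ∂μ, ‖g ω‖ ≤ 1 := by
        filter_upwards [hratio k l] with ω h
        rw [hgdef, norm_neg, Real.norm_of_nonneg (le_min h.1 zero_le_one)]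
        exact min_le_right _ _
      have hg : Integrable g μ := Integrable.of_bound hgm.aestronglyMeasurable 1 hgb
      have hWg : Integrable (W * g) μ := hWi.mul_bdd hgm.aestronglyMeasurable hgb
      have := aux_key (ℱ.le k) (hprod k l _ aux_convex (hminint l).neg hg) hg hW hWi hWg hW0 hWX
      rw [integral_neg, mul_neg, le_neg, ← integral_neg] at this
      refine this.trans (le_of_eq ?_)
      refine integral_congr_ae ?_
      refine Eventually.of_forall fun ω => ?_
      by_cases hω : ω ∈ auxT M t k
      · have hp : 0 < M k ω := ht.trans_le hω.1
        simp only [hWdef, Set.indicator_of_mem hω, hgdef, mul_neg, neg_neg]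
        rw [mul_min_of_nonneg _ _ hp.le, mul_div_cancel₀ _ hp.ne', mul_one]
      · simp [hWdef, Set.indicator_of_notMem hω]
    have hlim : Tendsto (fun l => ∫ ω, (auxT M t k).indicator
        (fun ω => min (M (k + l) ω) (M k ω)) ω ∂μ) atTop
        (𝓝 (∫ ω, (auxT M t k).indicator (fun ω => min (Minf ω) (M k ω)) ω ∂μ)) := by
      refine tendsto_integral_of_dominated_convergence (M k)
        (fun n => (((hmeas _).min (hmeas k)).indicator (hTm' t k)).aestronglyMeasurable)
        (hmart.integrable k) ?_ ?_
      · intro n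
        filter_upwards [hnn] with ω h
        by_cases hω : ω ∈ auxT M t k
        · rw [Set.indicator_of_mem hω, Real.norm_of_nonneg (le_min (h _) (h _))]
          exact min_le_right _ _
        · simpa [Set.indicator_of_notMem hω] using h k
      · filter_upwards [hconv] with ω h
        by_cases hω : ω ∈ auxT M t k
        · simp only [Set.indicator_of_mem hω]
          refine Tendsto.min ?_ tendsto_const_nhds
          have := (tendsto_add_atTop_iff_nat k).2 h
          simpa [add_comm] using this
        · simp [Set.indicator_of_notMem hω]
    have hB := le_of_tendsto_of_tendsto' (hclim.const_mul (∫ ω, W ω ∂μ)) hlim hA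
    have hWt : t * μ.real (auxT M t k) ≤ ∫ ω, W ω ∂μ := by
      have : ∫ ω, (auxT M t k).indicator (fun _ => t) ω ∂μ = t * μ.real (auxT M t k) := by
        rw [integral_indicator_const _ (hTm' t k), smul_eq_mul, mul_comm]
      rw [← this]
      refine integral_mono ((integrable_const t).indicator (hTm' t k)) hWi fun ω => ?_
      exact Set.indicator_le_indicator' (fun h => h.1)
    calc t * c * μ.real (auxT M t k) = t * μ.real (auxT M t k) * c := by ring
      _ ≤ (∫ ω, W ω ∂μ) * c := by gcongr
      _ ≤ _ := hB
      _ ≤ _ := by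
        refine integral_mono ((hinfint.inf (hmart.integrable k)).indicator (hTm' t k))
          (hinfint.indicator (hTm' t k)) fun ω => ?_
        exact Set.indicator_le_indicator (min_le_left _ _)
  have hEm : ∀ t : ℝ, MeasurableSet {ω | ∃ k, t ≤ M k ω} := by
    intro t
    rw [Set.ofPred_exists]
    exact MeasurableSet.iUnion fun k => measurableSet_le measurable_const (hmeas k)
  -- the tail of the limit
  have htail : Tendsto (fun N : ℕ => ∫ ω, {ω | ∃ k, (N : ℝ) ≤ M k ω}.indicator Minf ω ∂μ)
      atTop (𝓝 0) := by
    have : (0 : ℝ) = ∫ _ω : Ω, (0 : ℝ) ∂μ := by simp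
    rw [this]
    refine tendsto_integral_of_dominated_convergence (fun ω => ‖Minf ω‖)
      (fun n => (hMinf.indicator (hEm _)).aestronglyMeasurable) hinfint.norm ?_ ?_
    · exact fun n => Eventually.of_forall fun ω => norm_indicator_le_norm_self _ _
    · filter_upwards [hconv] with ω h
      obtain ⟨B, hB⟩ := h.bddAbove_range
      obtain ⟨N, hN⟩ := exists_nat_gt B
      refine tendsto_const_nhds.congr' ?_
      filter_upwards [eventually_ge_atTop N] with n hn
      rw [Set.indicator_of_notMem]
      rintro ⟨k, hk⟩
      have h1 : M k ω ≤ B := hB ⟨k, rfl⟩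
      have h2 : (N : ℝ) ≤ n := by exact_mod_cast hn
      linarith
  -- choose the level
  obtain ⟨N, hNε, hN2⟩ := ((htail.eventually_lt_const (show (0 : ℝ) < c / K by positivity)).and
    (eventually_ge_atTop 2)).exists
  set t : ℝ := (N : ℝ) with ht
  have ht1 : 1 < t := by
    have : (2 : ℝ) ≤ t := by rw [ht]; exact_mod_cast hN2
    linarith
  have ht0 : 0 < t := by linarith
  set ε : ℝ := ∫ ω, {ω | ∃ k, t ≤ M k ω}.indicator Minf ω ∂μ with hε
  set δ : ℝ := ε / (t * c) with hδ
  have hsum : ∀ n, ∑ k ∈ Finset.range n, μ.real (auxT M t k) ≤ δ := by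
    intro n
    rw [hδ, le_div_iff₀ (by positivity), mul_comm, Finset.mul_sum]
    refine (Finset.sum_le_sum fun k _ => hstep t ht0 k).trans ?_
    rw [← integral_finsetSum _ fun k _ => hinfint.indicator (hTm' t k)]
    refine integral_mono_ae (integrable_finsetSum _ fun k _ => hinfint.indicator (hTm' t k))
      (hinfint.indicator (hEm t)) ?_
    filter_upwards [hinf0] with ω h
    exact auxT_sum_le M t n ω (Minf ω) h
  have hδK : (K * t) ^ (1 : ℝ) * δ < 1 := by
    rw [Real.rpow_one, hδ]
    have : K * t * (ε / (t * c)) = ε / (c / K) := by field_simp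
    rw [this, div_lt_one (by positivity)]
    exact hNε
  have hδ0 : 0 ≤ δ := by simpa using hsum 0
  have hKt : 0 < K * t := by positivity
  obtain ⟨p, hpδ, hp1⟩ : ∃ p : ℝ, (K * t) ^ p * δ < 1 ∧ 1 < p := by
    have hcont : Continuous fun p : ℝ => (K * t) ^ p * δ :=
      (Real.continuous_const_rpow hKt.ne').mul continuous_const
    have h1 : ∀ᶠ p in 𝓝[>] (1 : ℝ), (K * t) ^ p * δ < 1 :=
      (hcont.continuousAt.eventually_lt_const hδK).filter_mono nhdsWithin_le_nhds
    exact (h1.and self_mem_nhdsWithin).exists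
  have hp0 : 0 < p := by linarith
  refine ⟨p, hp1, ?_⟩
  have hppos : ∀ n, ∀ᵐ ω ∂μ, ‖M n ω ^ p‖ ≤ (K ^ n) ^ p := by
    intro n
    filter_upwards [hnn, hpow] with ω h h1
    rw [Real.norm_of_nonneg (Real.rpow_nonneg (h n) p)]
    exact Real.rpow_le_rpow (h n) (h1 n) hp0.le
  have hpi : ∀ n, Integrable (fun ω => M n ω ^ p) μ := fun n =>
    Integrable.of_bound ((hmeas n).pow_const p).aestronglyMeasurable _ (hppos n)
  have hpp : ∀ n, 0 ≤ ∫ ω, M n ω ^ p ∂μ := by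
    intro n
    refine integral_nonneg_of_ae ?_
    filter_upwards [hnn] with ω h
    exact Real.rpow_nonneg (h n) p
  -- size at first passage
  have hfp : ∀ k, ∀ᵐ ω ∂μ, ω ∈ auxT M t k → M k ω ≤ K * t := by
    intro k
    filter_upwards [hbd, hone] with ω h h1 hω
    rcases k with _ | k
    · have := hω.1
      rw [h1] at this
      linarith
    · exact (h k).trans (by have := hω.2 k (Nat.lt_succ_self k); gcongr)
  have hT0 : μ.real (auxT M t 0) = 0 := by
    have : μ (auxT M t 0) = 0 := by
      refine measure_mono_null (t := {ω | ¬ M 0 ω = 1}) (fun ω hω hh => ?_) hone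
      have := hω.1
      rw [hh] at this
      linarith
    simp [Measure.real, this]
  -- decomposition
  have hdec : ∀ k l, ∫ ω, (auxT M t k).indicator (fun ω => M (k + l) ω ^ p) ω ∂μ
      ≤ ((K * t) ^ p * μ.real (auxT M t k)) * ∫ ω, M l ω ^ p ∂μ := by
    intro k l
    set W : Ω → ℝ := (auxT M t k).indicator (fun ω => M k ω ^ p) with hWdef
    have hW : StronglyMeasurable[ℱ k] W := by
      refine StronglyMeasurable.indicator ?_ (hTm t k)
      exact ((hsm k).measurable.pow_const p).stronglyMeasurable
    have hWi : Integrable W μ := (hpi k).indicator (hTm' t k)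
    have hW0 : ∀ᵐ ω ∂μ, 0 ≤ W ω := by
      filter_upwards [hnn] with ω h
      exact Set.indicator_apply_nonneg fun _ => (Real.rpow_nonneg (h k) p)
    have hWX : ∀ᵐ ω ∂μ, W ω ≠ 0 → 0 < M k ω := by
      refine Eventually.of_forall fun ω hω => ?_
      have : ω ∈ auxT M t k := Set.mem_of_indicator_ne_zero hω
      exact ht0.trans_le this.1
    set g : Ω → ℝ := fun ω => (M (k + l) ω / M k ω) ^ p with hgdef
    have hgm : Measurable g := (hrmeas k l).pow_const p
    have hgb : ∀ᵐ ω ∂μ, ‖g ω‖ ≤ (K ^ l) ^ p := by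
      filter_upwards [hratio k l] with ω h
      rw [hgdef, Real.norm_of_nonneg (Real.rpow_nonneg h.1 p)]
      exact Real.rpow_le_rpow h.1 h.2 hp0.le
    have hg : Integrable g μ := Integrable.of_bound hgm.aestronglyMeasurable _ hgb
    have hWg : Integrable (W * g) μ := hWi.mul_bdd hgm.aestronglyMeasurable hgb
    have := aux_key (ℱ.le k) (hprod k l (fun x => x ^ p) (convexOn_rpow hp1.le) (hpi l) hg)
      hg hW hWi hWg hW0 hWX
    have hWle : ∫ ω, W ω ∂μ ≤ (K * t) ^ p * μ.real (auxT M t k) := by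
      have h1 : ∫ ω, (auxT M t k).indicator (fun _ => (K * t) ^ p) ω ∂μ
          = (K * t) ^ p * μ.real (auxT M t k) := by
        rw [integral_indicator_const _ (hTm' t k), smul_eq_mul, mul_comm]
      rw [← h1]
      refine integral_mono_ae hWi ((integrable_const _).indicator (hTm' t k)) ?_
      filter_upwards [hfp k, hnn] with ω h h2
      refine Set.indicator_le_indicator' fun h3 => ?_
      exact Real.rpow_le_rpow (h2 k) (h h3) hp0.le
    refine le_trans (le_of_eq ?_) (this.trans (mul_le_mul_of_nonneg_right hWle (hpp l)))
    refine integral_congr_ae ?_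
    filter_upwards [hnn] with ω h
    by_cases hω : ω ∈ auxT M t k
    · have hp : 0 < M k ω := ht0.trans_le hω.1
      simp only [hWdef, Set.indicator_of_mem hω, hgdef]
      rw [← Real.mul_rpow hp.le (div_nonneg (h _) (h _)), mul_div_cancel₀ _ hp.ne']
    · simp [hWdef, Set.indicator_of_notMem hω]
  set ρ : ℝ := (K * t) ^ p * δ with hρ
  set B : ℝ := t ^ p / (1 - ρ) with hBdef
  have hρ1 : 0 < 1 - ρ := by linarith
  have hB0 : 0 ≤ B := by positivity
  have hmain : ∀ n, ∫ ω, M n ω ^ p ∂μ ≤ B := by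
    intro n
    induction n using Nat.strong_induction_on with
    | _ n ih =>
      have h1 : ∫ ω, M n ω ^ p ∂μ ≤ ∫ ω, (t ^ p + ∑ k ∈ Finset.range (n + 1),
          (auxT M t k).indicator (fun ω => M n ω ^ p) ω) ∂μ := by
        refine integral_mono_ae (hpi n) ((integrable_const _).add
          (integrable_finsetSum _ fun k _ => (hpi n).indicator (hTm' t k))) ?_
        filter_upwards [hnn] with ω h
        have hpos : ∀ k, 0 ≤ (auxT M t k).indicator (fun ω => M n ω ^ p) ω := fun k =>
          Set.indicator_apply_nonneg fun _ => (Real.rpow_nonneg (h n) p)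
        by_cases hcase : t ≤ M n ω
        · obtain ⟨k, hk, hkT⟩ := auxT_cover M t n ω hcase
          have h2 := Finset.single_le_sum (fun i _ => hpos i) hk
          rw [Set.indicator_of_mem hkT] at h2
          have : 0 ≤ t ^ p := by positivity
          linarith
        · have h2 : M n ω ^ p ≤ t ^ p := Real.rpow_le_rpow (h n) (not_le.1 hcase).le hp0.le
          have h3 := Finset.sum_nonneg (s := Finset.range (n + 1)) fun i _ => hpos i
          linarith
      rw [integral_add (integrable_const _)
        (integrable_finsetSum _ fun k _ => (hpi n).indicator (hTm' t k)),
        integral_finsetSum _ fun k _ => (hpi n).indicator (hTm' t k)] at h1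
      have h2 : ∑ k ∈ Finset.range (n + 1), ∫ ω, (auxT M t k).indicator
          (fun ω => M n ω ^ p) ω ∂μ ≤ ∑ k ∈ Finset.range (n + 1),
            ((K * t) ^ p * μ.real (auxT M t k)) * B := by
        refine Finset.sum_le_sum fun k hk => ?_
        have hkn : k ≤ n := Nat.lt_succ_iff.1 (Finset.mem_range.1 hk)
        have h3 := hdec k (n - k)
        rw [Nat.add_sub_cancel' hkn] at h3
        refine h3.trans ?_
        rcases Nat.eq_zero_or_pos k with rfl | hkpos
        · simp [hT0]
        · exact mul_le_mul_of_nonneg_left (ih (n - k) (by omega)) (by positivity)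
      have h4 : ∑ k ∈ Finset.range (n + 1), ((K * t) ^ p * μ.real (auxT M t k)) * B ≤ ρ * B := by
        rw [← Finset.sum_mul, ← Finset.mul_sum]
        have := hsum (n + 1)
        rw [hρ]
        gcongr
      have h5 : t ^ p + ρ * B = B := by
        rw [hBdef]; field_simp; ring
      have h6 : ∫ _ω : Ω, t ^ p ∂μ = t ^ p := by simp
      linarith
  refine lt_of_le_of_lt (iSup_le fun n => ?_) (ENNReal.ofReal_lt_top (r := B))
  rw [← ofReal_integral_eq_lintegral_ofReal (hpi n)]
  · exact ENNReal.ofReal_le_ofReal (hmain n)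
  · filter_upwards [hnn] with ω h
    exact Real.rpow_nonneg (h n) p
end

section
/- Let (M_n) be a nonnegative martingale with M_0 = 1 satisfying the product-structure condition (2.1), and assume there exists K > 1 with P(M_{n+1} ≥ M_n/K) = 1 for all n ∈ ℕ and P(M_∞ > 0) = 1. Then the set { ε ∈ ℝ : ε > 0 and sup_{n∈ℕ} E[M_n^{−ε}] < ∞ } is an open subset of ℝ. -/
open MeasureTheory ProbabilityTheory Filter Topology

lemma aux_tangent {p x y : ℝ} (hp : 0 < p) (hx : 0 < x) (hy : 0 < y) :
    (1 + p) * x ^ (-p) ≤ y ^ (-p) + p * (x ^ (-p - 1) * y) := by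
  have h1 : 1 - p * (y / x - 1) ≤ (y / x) ^ (-p) := by
    have hyx : 0 < y / x := div_pos hy hx
    rw [Real.rpow_def_of_pos hyx]
    have h2 := Real.add_one_le_exp (Real.log (y / x) * -p)
    have h3 := Real.log_le_sub_one_of_pos hyx
    nlinarith
  rw [Real.div_rpow hy.le hx.le] at h1
  have hxp : 0 < x ^ (-p) := Real.rpow_pos_of_pos hx _
  rw [le_div_iff₀ hxp] at h1
  rw [Real.rpow_sub_one hx.ne']
  have : x ^ (-p) / x * y = y / x * x ^ (-p) := by ring
  rw [this]
  nlinarith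

lemma aux_convex_s5 {p δ : ℝ} (hp : 0 < p) (hδ : 0 < δ) :
    ConvexOn ℝ (Set.Ici 0) (fun x : ℝ => (x + δ) ^ (-p)) := by
  refine ⟨convex_Ici 0, ?_⟩
  intro x hx y hy a b ha hb hab
  simp only [Set.mem_Ici, smul_eq_mul] at *
  have hz : 0 < a * x + b * y + δ := by positivity
  have h1 := aux_tangent hp hz (show 0 < x + δ by positivity)
  have h2 := aux_tangent hp hz (show 0 < y + δ by positivity)
  have h3 := mul_le_mul_of_nonneg_left h1 ha
  have h4 := mul_le_mul_of_nonneg_left h2 hb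
  set z := a * x + b * y + δ with hzd
  have h5 : z ^ (-p) = z ^ (-p - 1) * z := by
    rw [Real.rpow_sub_one hz.ne']; field_simp
  have h6 : z = a * (x + δ) + b * (y + δ) := by
    rw [hzd]; linear_combination (-δ) * hab
  have h7 : a * (p * (z ^ (-p - 1) * (x + δ))) + b * (p * (z ^ (-p - 1) * (y + δ)))
      = p * z ^ (-p) := by
    rw [h5]; linear_combination (-p * z ^ (-p-1)) * h6
  have h8 : a * ((1 + p) * z ^ (-p)) + b * ((1 + p) * z ^ (-p)) = (1 + p) * z ^ (-p) := by
    linear_combination ((1 + p) * z ^ (-p)) * hab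
  linarith

section
variable {Ω : Type*} {m0 : MeasurableSpace Ω} {μ : Measure Ω} [IsProbabilityMeasure μ]

lemma aux_pull {m : MeasurableSpace Ω} (hm : m ≤ m0) {g X : Ω → ℝ} {c : ℝ}
    (hg : StronglyMeasurable[m] g) (hgb : ∀ᵐ ω ∂μ, ‖g ω‖ ≤ c) (hX : Integrable X μ) :
    ∫ ω, g ω * X ω ∂μ = ∫ ω, g ω * (μ[X | m]) ω ∂μ := by
  have hi : Integrable (g * X) μ := hX.bdd_mul (hg.mono hm).aestronglyMeasurable hgb
  have h := condExp_mul_of_stronglyMeasurable_left hg hi hX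
  have h2 := integral_condExp (μ := μ) (f := g * X) hm
  rw [integral_congr_ae h] at h2
  exact h2.symm

/-- the weight `1_A M_k^{-q}` -/
lemma aux_weight {m : MeasurableSpace Ω} {Y : Ω → ℝ} {c q : ℝ}
    (hY : StronglyMeasurable[m] Y) (hc : 0 < c) (hcY : ∀ᵐ ω ∂μ, c ≤ Y ω) (hq : q ≤ 0)
    {A : Set Ω} (hA : MeasurableSet[m] A) :
    StronglyMeasurable[m] (A.indicator (fun ω => Y ω ^ q)) ∧
    (∀ᵐ ω ∂μ, 0 ≤ A.indicator (fun ω => Y ω ^ q) ω) ∧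
    (∀ᵐ ω ∂μ, ‖A.indicator (fun ω => Y ω ^ q) ω‖ ≤ c ^ q) := by
  refine ⟨?_, ?_, ?_⟩
  · exact StronglyMeasurable.indicator (hY.measurable.pow_const q).stronglyMeasurable hA
  · filter_upwards [hcY] with ω h
    exact Set.indicator_apply_nonneg fun _ => Real.rpow_nonneg (hc.le.trans h) _
  · filter_upwards [hcY] with ω h
    have h0 := Real.rpow_nonneg (hc.le.trans h) q
    refine (norm_indicator_le_norm_self _ _).trans ?_
    rw [Real.norm_of_nonneg h0]
    exact Real.rpow_le_rpow_of_nonpos hc h hq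

variable {ℱ : Filtration ℕ m0} {M : ℕ → Ω → ℝ}

lemma aux_jensen (hmart : Martingale M ℱ μ) (hnonneg : ∀ n, 0 ≤ᵐ[μ] M n)
    {Minf : Ω → ℝ} (hMinf : Measurable Minf)
    (hconv : ∀ᵐ ω ∂μ, Tendsto (fun n => M n ω) atTop (𝓝 (Minf ω)))
    (hpos : ∀ᵐ ω ∂μ, 0 < Minf ω) {k : ℕ} {c : ℝ} (hc : 0 < c) (hck : ∀ᵐ ω ∂μ, c ≤ M k ω)
    {p : ℝ} (hp : 0 < p) {A : Set Ω} (hA : MeasurableSet[ℱ k] A) :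
    ∫⁻ ω in A, ENNReal.ofReal (M k ω ^ (-p)) ∂μ ≤
      ∫⁻ ω in A, ENNReal.ofReal (Minf ω ^ (-p)) ∂μ := by
  have hA0 : MeasurableSet A := ℱ.le k _ hA
  obtain ⟨hg1, hg2, hg3⟩ := aux_weight (q := -p - 1) (μ := μ) (hmart.stronglyAdapted k) hc hck
    (by linarith) hA
  set g := A.indicator (fun ω => M k ω ^ (-p - 1)) with hg
  have hMm : ∀ n, Measurable (M n) := fun n => ((hmart.stronglyMeasurable n).mono (ℱ.le n)).measurable
  have hgm : Measurable g := (hg1.mono (ℱ.le k)).measurable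
  have hint : ∀ n, Integrable (fun ω => g ω * M n ω) μ := fun n =>
    (hmart.integrable n).bdd_mul hgm.aestronglyMeasurable hg3
  have hnn : ∀ n, 0 ≤ᵐ[μ] fun ω => g ω * M n ω := fun n => by
    filter_upwards [hg2, hnonneg n] with ω h1 h2 using mul_nonneg h1 h2
  have heq : ∀ n, k ≤ n → ∫⁻ ω, ENNReal.ofReal (g ω * M n ω) ∂μ =
      ∫⁻ ω, ENNReal.ofReal (g ω * M k ω) ∂μ := by
    intro n hn
    rw [← ofReal_integral_eq_lintegral_ofReal (hint n) (hnn n),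
      ← ofReal_integral_eq_lintegral_ofReal (hint k) (hnn k),
      aux_pull (ℱ.le k) hg1 hg3 (hmart.integrable n)]
    congr 1
    refine integral_congr_ae ?_
    filter_upwards [hmart.condExp_ae_eq hn] with ω h
    rw [h]
  have hfat : ∫⁻ ω, ENNReal.ofReal (g ω * Minf ω) ∂μ ≤
      ∫⁻ ω, ENNReal.ofReal (g ω * M k ω) ∂μ := by
    calc ∫⁻ ω, ENNReal.ofReal (g ω * Minf ω) ∂μ
        = ∫⁻ ω, liminf (fun n => ENNReal.ofReal (g ω * M n ω)) atTop ∂μ := by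
          refine lintegral_congr_ae ?_
          filter_upwards [hconv] with ω h
          exact ((ENNReal.continuous_ofReal.tendsto _).comp (h.const_mul (g ω))).liminf_eq.symm
      _ ≤ liminf (fun n => ∫⁻ ω, ENNReal.ofReal (g ω * M n ω) ∂μ) atTop :=
          lintegral_liminf_le' fun n => ((hgm.mul (hMm n)).ennreal_ofReal).aemeasurable
      _ = ∫⁻ ω, ENNReal.ofReal (g ω * M k ω) ∂μ := by
          refine (tendsto_const_nhds.congr' ?_).liminf_eq
          filter_upwards [eventually_ge_atTop k] with n hn using (heq n hn).symm
  have hgk : ∫⁻ ω, ENNReal.ofReal (g ω * M k ω) ∂μ =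
      ∫⁻ ω in A, ENNReal.ofReal (M k ω ^ (-p)) ∂μ := by
    rw [← lintegral_indicator hA0]
    refine lintegral_congr_ae ?_
    filter_upwards [hck] with ω h
    by_cases hω : ω ∈ A
    · simp only [hg, Set.indicator_of_mem hω]
      have : M k ω ≠ 0 := (hc.trans_le h).ne'
      rw [Real.rpow_sub_one this, div_mul_cancel₀ _ this]
    · simp [hg, Set.indicator_of_notMem hω]
  have hginf : ∫⁻ ω, ENNReal.ofReal (g ω * Minf ω) ∂μ =
      ∫⁻ ω in A, ENNReal.ofReal (M k ω ^ (-p - 1) * Minf ω) ∂μ := by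
    rw [← lintegral_indicator hA0]
    refine lintegral_congr fun ω => ?_
    by_cases hω : ω ∈ A
    · simp only [hg, Set.indicator_of_mem hω]
    · simp [hg, Set.indicator_of_notMem hω]
  rw [hgk, hginf] at hfat
  set I := ∫⁻ ω in A, ENNReal.ofReal (M k ω ^ (-p)) ∂μ with hI
  have hIfin : I ≠ ⊤ := by
    rw [← hgk, ← ofReal_integral_eq_lintegral_ofReal (hint k) (hnn k)]
    exact ENNReal.ofReal_ne_top
  have hmain : I + ENNReal.ofReal p * I ≤
      (∫⁻ ω in A, ENNReal.ofReal (Minf ω ^ (-p)) ∂μ) + ENNReal.ofReal p * I := by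
    calc I + ENNReal.ofReal p * I
        = ∫⁻ ω in A, ENNReal.ofReal ((1 + p) * M k ω ^ (-p)) ∂μ := by
          simp_rw [ENNReal.ofReal_mul (show 0 ≤ 1 + p by linarith)]
          rw [lintegral_const_mul _ ((hMm k).pow_const _).ennreal_ofReal,
            ENNReal.ofReal_add zero_le_one hp.le, ← hI, add_mul, ENNReal.ofReal_one, one_mul]
      _ ≤ ∫⁻ ω in A, (ENNReal.ofReal (Minf ω ^ (-p)) +
            ENNReal.ofReal p * ENNReal.ofReal (M k ω ^ (-p - 1) * Minf ω)) ∂μ := by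
          refine lintegral_mono_ae (ae_restrict_of_ae ?_)
          filter_upwards [hck, hpos] with ω h1 h2
          rw [← ENNReal.ofReal_mul hp.le, ← ENNReal.ofReal_add]
          · exact ENNReal.ofReal_le_ofReal (aux_tangent hp (hc.trans_le h1) h2)
          · exact Real.rpow_nonneg h2.le _
          · have := Real.rpow_nonneg (hc.le.trans h1) (-p - 1)
            positivity
      _ = (∫⁻ ω in A, ENNReal.ofReal (Minf ω ^ (-p)) ∂μ) + ENNReal.ofReal p *
            ∫⁻ ω in A, ENNReal.ofReal (M k ω ^ (-p - 1) * Minf ω) ∂μ := by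
          rw [lintegral_add_left (hMinf.pow_const _).ennreal_ofReal, lintegral_const_mul]
          exact (((hMm k).pow_const _).mul hMinf).ennreal_ofReal
      _ ≤ _ := by gcongr
  exact (ENNReal.add_le_add_iff_right (ENNReal.mul_ne_top ENNReal.ofReal_ne_top hIfin)).1 hmain

lemma aux_prod (hmart : Martingale M ℱ μ)
    (hprod : ∀ k l : ℕ, ∀ f : ℝ → ℝ, ConvexOn ℝ (Set.Ici 0) f →
      Integrable (fun ω => f (M l ω)) μ →
      Integrable (fun ω => f (M (k + l) ω / M k ω)) μ →
      ∀ᵐ ω ∂μ, 0 < M k ω →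
        (μ[fun ω' => f (M (k + l) ω' / M k ω') | ℱ k]) ω ≤ ∫ ω', f (M l ω') ∂μ)
    {c : ℕ → ℝ} (hc : ∀ n, 0 < c n) (hcM : ∀ n, ∀ᵐ ω ∂μ, c n ≤ M n ω)
    {p : ℝ} (hp : 0 < p) (k l : ℕ) {A : Set Ω} (hA : MeasurableSet[ℱ k] A) :
    ∫⁻ ω in A, ENNReal.ofReal (M (k + l) ω ^ (-p)) ∂μ ≤
      (∫⁻ ω in A, ENNReal.ofReal (M k ω ^ (-p)) ∂μ) *
        ∫⁻ ω, ENNReal.ofReal (M l ω ^ (-p)) ∂μ := by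
  have hA0 : MeasurableSet A := ℱ.le k _ hA
  obtain ⟨hg1, hg2, hg3⟩ := aux_weight (q := -p) (μ := μ) (hmart.stronglyAdapted k) (hc k) (hcM k)
    (by linarith) hA
  set g := A.indicator (fun ω => M k ω ^ (-p)) with hg
  have hMm : ∀ n, Measurable (M n) := fun n => ((hmart.stronglyMeasurable n).mono (ℱ.le n)).measurable
  have hgm : Measurable g := (hg1.mono (ℱ.le k)).measurable
  have hbd : ∀ δ : ℝ, 0 < δ → ∀ X : Ω → ℝ, Measurable X → (∀ᵐ ω ∂μ, 0 ≤ X ω) →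
      Integrable (fun ω => (X ω + δ) ^ (-p)) μ := by
    intro δ hδ X hX hX0
    refine Integrable.of_bound ((hX.add_const δ).pow_const _).aestronglyMeasurable (δ ^ (-p)) ?_
    filter_upwards [hX0] with ω h
    rw [Real.norm_of_nonneg (by positivity)]
    exact Real.rpow_le_rpow_of_nonpos hδ (by linarith) (by linarith)
  set R := fun ω => M (k + l) ω / M k ω with hR
  have hRm : Measurable R := (hMm _).div (hMm _)
  have hRpos : ∀ᵐ ω ∂μ, 0 < R ω := by
    filter_upwards [hcM (k + l), hcM k] with ω h1 h2
    exact div_pos ((hc _).trans_le h1) ((hc _).trans_le h2)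
  have hlpos : ∀ᵐ ω ∂μ, 0 < M l ω := by
    filter_upwards [hcM l] with ω h1 using (hc _).trans_le h1
  have hgint : Integrable g μ := Integrable.of_bound hgm.aestronglyMeasurable _ hg3
  have hgA : ∫⁻ ω, ENNReal.ofReal (g ω) ∂μ = ∫⁻ ω in A, ENNReal.ofReal (M k ω ^ (-p)) ∂μ := by
    rw [← lintegral_indicator hA0]
    refine lintegral_congr fun ω => ?_
    by_cases hω : ω ∈ A
    · simp only [hg, Set.indicator_of_mem hω]
    · simp [hg, Set.indicator_of_notMem hω]
  have hstep : ∀ δ : ℝ, 0 < δ → ∫⁻ ω, ENNReal.ofReal (g ω * (R ω + δ) ^ (-p)) ∂μ ≤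
      (∫⁻ ω in A, ENNReal.ofReal (M k ω ^ (-p)) ∂μ) *
        ∫⁻ ω, ENNReal.ofReal (M l ω ^ (-p)) ∂μ := by
    intro δ hδ
    have hi1 := hbd δ hδ (M l) (hMm l) (hlpos.mono fun _ h => h.le)
    have hi2 := hbd δ hδ R hRm (hRpos.mono fun _ h => h.le)
    have hce := hprod k l (fun x => (x + δ) ^ (-p)) (aux_convex_s5 hp hδ) hi1 hi2
    have hi3 : Integrable (fun ω => g ω * (R ω + δ) ^ (-p)) μ :=
      hi2.bdd_mul hgm.aestronglyMeasurable hg3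
    rw [← ofReal_integral_eq_lintegral_ofReal hi3, aux_pull (ℱ.le k) hg1 hg3 hi2]
    · calc ENNReal.ofReal (∫ ω, g ω * (μ[fun ω => (R ω + δ) ^ (-p) | ℱ k]) ω ∂μ)
          ≤ ENNReal.ofReal (∫ ω, g ω * (∫ ω', (M l ω' + δ) ^ (-p) ∂μ) ∂μ) := by
            refine ENNReal.ofReal_le_ofReal (integral_mono_ae ?_ (hgint.mul_const _) ?_)
            · exact integrable_condExp.bdd_mul hgm.aestronglyMeasurable hg3
            · filter_upwards [hce, hg2, hcM k] with ω h1 h2 h3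
              exact mul_le_mul_of_nonneg_left (h1 ((hc k).trans_le h3)) h2
        _ = (∫⁻ ω in A, ENNReal.ofReal (M k ω ^ (-p)) ∂μ) *
              ∫⁻ ω, ENNReal.ofReal ((M l ω + δ) ^ (-p)) ∂μ := by
            rw [integral_mul_const, ENNReal.ofReal_mul (integral_nonneg_of_ae hg2),
              ofReal_integral_eq_lintegral_ofReal hgint hg2,
              ofReal_integral_eq_lintegral_ofReal hi1, hgA]
            filter_upwards [hlpos] with ω h
            exact Real.rpow_nonneg (by positivity) _
        _ ≤ _ := by
            refine mul_le_mul' le_rfl ?_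
            refine lintegral_mono_ae ?_
            filter_upwards [hlpos] with ω h
            exact ENNReal.ofReal_le_ofReal
              (Real.rpow_le_rpow_of_nonpos h (by linarith) (by linarith))
    · filter_upwards [hg2, hRpos] with ω h1 h2
      exact mul_nonneg h1 (Real.rpow_nonneg (by positivity) _)
  calc ∫⁻ ω in A, ENNReal.ofReal (M (k + l) ω ^ (-p)) ∂μ
      = ∫⁻ ω, liminf (fun n : ℕ =>
          ENNReal.ofReal (g ω * (R ω + 1 / ((n : ℝ) + 1)) ^ (-p))) atTop ∂μ := by
        rw [← lintegral_indicator hA0]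
        refine lintegral_congr_ae ?_
        filter_upwards [hRpos, hcM k, hcM (k + l)] with ω h1 h2 h3
        have ht : Tendsto (fun n : ℕ => g ω * (R ω + 1 / ((n : ℝ) + 1)) ^ (-p)) atTop
            (𝓝 (g ω * (R ω) ^ (-p))) := by
          refine Tendsto.const_mul _ ?_
          have h4 : Tendsto (fun n : ℕ => R ω + 1 / ((n : ℝ) + 1)) atTop (𝓝 (R ω)) := by
            simpa using (tendsto_const_nhds (x := R ω)).add
              (tendsto_one_div_add_atTop_nhds_zero_nat (𝕜 := ℝ))
          exact h4.rpow_const (Or.inl h1.ne')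
        have h5 := ((ENNReal.continuous_ofReal.tendsto _).comp ht).liminf_eq
        simp only [Function.comp_def] at h5
        rw [h5]
        by_cases hω : ω ∈ A
        · simp only [hg, Set.indicator_of_mem hω, hR]
          have h6 : 0 < M k ω := (hc _).trans_le h2
          have h7 : 0 < M (k + l) ω := (hc _).trans_le h3
          rw [← Real.mul_rpow h6.le (by positivity), mul_div_cancel₀ _ h6.ne']
        · simp [hg, Set.indicator_of_notMem hω]
    _ ≤ liminf (fun n : ℕ => ∫⁻ ω,
          ENNReal.ofReal (g ω * (R ω + 1 / ((n : ℝ) + 1)) ^ (-p)) ∂μ) atTop :=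
        lintegral_liminf_le' fun n =>
          ((hgm.mul ((hRm.add_const _).pow_const _)).ennreal_ofReal).aemeasurable
    _ ≤ _ := by
        refine (liminf_le_liminf (Eventually.of_forall fun n => ?_)).trans
          (liminf_const (f := (atTop : Filter ℕ)) _).le
        exact hstep _ (by positivity)
end

/-- **Theorem 2.2 (iv), openness part**: for a nonnegative martingale with `M 0 = 1`
satisfying the product structure condition (2.1), with `M (n+1) ≥ M n / K` a.s. for some
`K > 1` and `P(M_∞ > 0) = 1`, the set of `ε > 0` with `sup_n E[M n ^ (-ε)] < ∞` is an
open subset of `ℝ`. -/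
theorem nonneg_martingale_prod_structure_neg_moment_set_open
    {Ω : Type*} {m0 : MeasurableSpace Ω} {μ : Measure Ω} [IsProbabilityMeasure μ]
    {ℱ : Filtration ℕ m0} {M : ℕ → Ω → ℝ}
    (hmart : Martingale M ℱ μ)
    (hnonneg : ∀ n, 0 ≤ᵐ[μ] M n)
    (hone : M 0 =ᵐ[μ] fun _ => 1)
    {Minf : Ω → ℝ} (hMinf : Measurable Minf)
    (hconv : ∀ᵐ ω ∂μ, Tendsto (fun n => M n ω) atTop (𝓝 (Minf ω)))
    (hprod : ∀ k l : ℕ, ∀ f : ℝ → ℝ, ConvexOn ℝ (Set.Ici 0) f →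
      Integrable (fun ω => f (M l ω)) μ →
      Integrable (fun ω => f (M (k + l) ω / M k ω)) μ →
      ∀ᵐ ω ∂μ, 0 < M k ω →
        (μ[fun ω' => f (M (k + l) ω' / M k ω') | ℱ k]) ω ≤ ∫ ω', f (M l ω') ∂μ)
    {K : ℝ} (hK : 1 < K)
    (hlow : ∀ n : ℕ, ∀ᵐ ω ∂μ, M n ω / K ≤ M (n + 1) ω)
    (hpos : ∀ᵐ ω ∂μ, 0 < Minf ω) :
    IsOpen {ε : ℝ | 0 < ε ∧ (⨆ n, ∫⁻ ω, ENNReal.ofReal (M n ω ^ (-ε)) ∂μ) < ⊤} := by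
  classical
  have hK0 : 0 < K := by linarith
  have hMm : ∀ n, Measurable (M n) := fun n =>
    ((hmart.stronglyMeasurable n).mono (ℱ.le n)).measurable
  -- deterministic lower bounds
  have hcM : ∀ n : ℕ, ∀ᵐ ω ∂μ, (K⁻¹) ^ n ≤ M n ω := by
    intro n
    induction n with
    | zero => filter_upwards [hone] with ω h; simp [h]
    | succ n ih =>
      filter_upwards [ih, hlow n] with ω h1 h2
      refine le_trans ?_ h2
      rw [pow_succ, div_eq_mul_inv]
      exact mul_le_mul_of_nonneg_right h1 (by positivity)
  have hc : ∀ n : ℕ, 0 < (K⁻¹) ^ n := fun n => by positivity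
  have hMpos : ∀ᵐ ω ∂μ, ∀ n, 0 < M n ω := by
    rw [ae_all_iff]; intro n
    filter_upwards [hcM n] with ω h using (hc n).trans_le h
  -- downward closedness
  have hdown : ∀ p ε : ℝ, 0 < p → p ≤ ε →
      (⨆ n, ∫⁻ ω, ENNReal.ofReal (M n ω ^ (-ε)) ∂μ) < ⊤ →
      (⨆ n, ∫⁻ ω, ENNReal.ofReal (M n ω ^ (-p)) ∂μ) < ⊤ := by
    intro p ε hp hpe hfin
    refine lt_of_le_of_lt (b := 1 + (⨆ n, ∫⁻ ω, ENNReal.ofReal (M n ω ^ (-ε)) ∂μ)) ?_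
      (ENNReal.add_lt_top.2 ⟨ENNReal.one_lt_top, hfin⟩)
    refine iSup_le fun n => ?_
    calc ∫⁻ ω, ENNReal.ofReal (M n ω ^ (-p)) ∂μ
        ≤ ∫⁻ ω, (1 + ENNReal.ofReal (M n ω ^ (-ε))) ∂μ := by
          refine lintegral_mono_ae ?_
          filter_upwards [hMpos] with ω h
          have h0 := Real.rpow_nonneg (h n).le (-ε)
          rw [← ENNReal.ofReal_one, ← ENNReal.ofReal_add zero_le_one h0]
          refine ENNReal.ofReal_le_ofReal ?_
          rcases le_total 1 (M n ω) with h1 | h1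
          · have := Real.rpow_le_one_of_one_le_of_nonpos h1 (show -p ≤ 0 by linarith)
            linarith
          · have := Real.rpow_le_rpow_of_exponent_ge (h n) h1 (show -ε ≤ -p by linarith)
            linarith
      _ = 1 + ∫⁻ ω, ENNReal.ofReal (M n ω ^ (-ε)) ∂μ := by
          rw [lintegral_add_left measurable_const]; simp
      _ ≤ _ := by
          gcongr
          exact le_iSup (fun n => ∫⁻ ω, ENNReal.ofReal (M n ω ^ (-ε)) ∂μ) n
  -- self improvement
  have hup : ∀ ε : ℝ, 0 < ε → (⨆ n, ∫⁻ ω, ENNReal.ofReal (M n ω ^ (-ε)) ∂μ) < ⊤ →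
      ∃ p, ε < p ∧ (⨆ n, ∫⁻ ω, ENNReal.ofReal (M n ω ^ (-p)) ∂μ) < ⊤ := by
    intro ε hε hfin
    have hinf : ∫⁻ ω, ENNReal.ofReal (Minf ω ^ (-ε)) ∂μ ≠ ⊤ := by
      refine ne_top_of_le_ne_top hfin.ne ?_
      calc ∫⁻ ω, ENNReal.ofReal (Minf ω ^ (-ε)) ∂μ
          = ∫⁻ ω, liminf (fun n => ENNReal.ofReal (M n ω ^ (-ε))) atTop ∂μ := by
            refine lintegral_congr_ae ?_
            filter_upwards [hconv, hpos] with ω h h'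
            exact ((ENNReal.continuous_ofReal.tendsto _).comp
              (h.rpow_const (Or.inl h'.ne'))).liminf_eq.symm
        _ ≤ liminf (fun n => ∫⁻ ω, ENNReal.ofReal (M n ω ^ (-ε)) ∂μ) atTop :=
            lintegral_liminf_le' fun n => (((hMm n).pow_const _).ennreal_ofReal).aemeasurable
        _ ≤ liminf (fun _ : ℕ => ⨆ n, ∫⁻ ω, ENNReal.ofReal (M n ω ^ (-ε)) ∂μ) atTop :=
            liminf_le_liminf (Eventually.of_forall fun n =>
              le_iSup (fun n => ∫⁻ ω, ENNReal.ofReal (M n ω ^ (-ε)) ∂μ) n)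
        _ = _ := liminf_const _
    let B : ℕ → Set Ω := fun j => {ω | ∃ n, M n ω ≤ 1 / ((j : ℝ) + 2)}
    have hBm : ∀ j, MeasurableSet (B j) := by
      intro j
      have : B j = ⋃ n, {ω | M n ω ≤ 1 / ((j : ℝ) + 2)} := by ext ω; simp [B]
      rw [this]
      exact MeasurableSet.iUnion fun n => measurableSet_le (hMm n) measurable_const
    have hBanti : Antitone B := by
      rintro i j hij ω ⟨n, hn⟩
      refine ⟨n, hn.trans ?_⟩
      have : (i : ℝ) ≤ j := by exact_mod_cast hij
      exact one_div_le_one_div_of_le (by positivity) (by linarith)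
    have hB0 : μ (⋂ j, B j) = 0 := by
      rw [← compl_compl (⋂ j, B j), ← mem_ae_iff]
      filter_upwards [hMpos, hconv, hpos] with ω h1 h2 h3
      obtain ⟨U, hU⟩ := (h2.inv₀ h3.ne').bddAbove_range
      obtain ⟨j, hj⟩ := exists_nat_gt U
      intro hω
      obtain ⟨n, hn⟩ := Set.mem_iInter.1 hω j
      have h4 : (M n ω)⁻¹ ≤ U := hU ⟨n, rfl⟩
      have h5 : (j : ℝ) + 2 ≤ (M n ω)⁻¹ := by
        rw [le_inv_comm₀ (by positivity) (h1 n)]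
        simpa using hn
      linarith
    have hBt : Tendsto (fun j => ∫⁻ ω in B j, ENNReal.ofReal (Minf ω ^ (-ε)) ∂μ) atTop (𝓝 0) := by
      refine tendsto_setLIntegral_zero hinf ?_
      rw [← hB0]
      exact tendsto_measure_iInter_atTop (fun j => (hBm j).nullMeasurableSet) hBanti
        ⟨0, measure_ne_top _ _⟩
    have hquarter : (0 : ENNReal) < 1 / 4 := by norm_num
    obtain ⟨j, hj⟩ := (hBt.eventually (gt_mem_nhds hquarter)).exists
    set b : ℝ := 1 / ((j : ℝ) + 2) with hb
    have hb0 : 0 < b := by positivity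
    have hb1 : b < 1 := by
      rw [hb, div_lt_one (by positivity)]
      have : (0 : ℝ) ≤ j := by positivity
      linarith
    -- choice of eta
    have hbK : 0 < b / K := by positivity
    obtain ⟨η, hη0, hη⟩ : ∃ η : ℝ, 0 < η ∧ (b / K) ^ (-η) ≤ 2 := by
      have ht : Tendsto (fun x : ℝ => (b / K) ^ (-x)) (𝓝[>] 0) (𝓝 1) := by
        have hcts : Continuous (fun x : ℝ => (b / K) ^ (-x)) :=
          continuous_const.rpow continuous_neg (fun x => Or.inl hbK.ne')
        have := hcts.tendsto 0
        simp only [neg_zero, Real.rpow_zero] at this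
        exact this.mono_left nhdsWithin_le_nhds
      obtain ⟨η, h1, h2⟩ := ((ht.eventually (gt_mem_nhds (show (1 : ℝ) < 2 by norm_num))).and
        self_mem_nhdsWithin).exists
      exact ⟨η, h2, h1.le⟩
    refine ⟨ε + η, by linarith, ?_⟩
    set p := ε + η with hp
    have hp0 : 0 < p := by linarith
    let A : ℕ → Set Ω := fun k => {ω | M k ω ≤ b ∧ ∀ i < k, b < M i ω}
    have hAm : ∀ k, MeasurableSet[ℱ k] (A k) := by
      intro k
      have hAeq : A k = {ω | M k ω ≤ b} ∩ ⋂ i, ⋂ (_ : i < k), {ω | b < M i ω} := by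
        ext ω; simp [A]
      rw [hAeq]
      refine MeasurableSet.inter ?_ (MeasurableSet.iInter fun i => MeasurableSet.iInter fun hi => ?_)
      · exact measurableSet_le (hmart.stronglyAdapted k).measurable measurable_const
      · exact measurableSet_lt measurable_const
          ((hmart.stronglyAdapted i).mono (ℱ.mono hi.le)).measurable
    have hAm0 : ∀ k, MeasurableSet (A k) := fun k => ℱ.le k _ (hAm k)
    have hAdisj : ∀ s : Set ℕ, s.PairwiseDisjoint A := by
      intro s k _ l _ hkl
      refine Set.disjoint_left.2 fun ω hk hl => ?_
      rcases lt_or_gt_of_ne hkl with h | h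
      · exact absurd hk.1 (not_le.2 (hl.2 k h))
      · exact absurd hl.1 (not_le.2 (hk.2 l h))
    have hA0 : μ (A 0) = 0 := by
      rw [← compl_compl (A 0), ← mem_ae_iff]
      filter_upwards [hone] with ω h hω
      have := hω.1
      rw [h] at this
      linarith
    -- overshoot bound
    have hover : ∀ k, ∫⁻ ω in A k, ENNReal.ofReal (M k ω ^ (-p)) ∂μ ≤
        2 * ∫⁻ ω in A k, ENNReal.ofReal (Minf ω ^ (-ε)) ∂μ := by
      intro k
      rcases k with _ | k
      · rw [setLIntegral_measure_zero _ _ hA0]; exact zero_le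
      calc ∫⁻ ω in A (k + 1), ENNReal.ofReal (M (k + 1) ω ^ (-p)) ∂μ
          ≤ ∫⁻ ω in A (k + 1), 2 * ENNReal.ofReal (M (k + 1) ω ^ (-ε)) ∂μ := by
            refine lintegral_mono_ae ?_
            refine (ae_restrict_iff' (hAm0 _)).2 ?_
            filter_upwards [hMpos, hlow k] with ω h1 h2 hω
            have h3 : b < M k ω := hω.2 k (Nat.lt_succ_self k)
            have h4 : b / K ≤ M (k + 1) ω :=
              le_trans (div_le_div_of_nonneg_right h3.le hK0.le) h2
            have h5 : M (k + 1) ω ^ (-p) = M (k + 1) ω ^ (-η) * M (k + 1) ω ^ (-ε) := by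
              rw [← Real.rpow_add (h1 _)]; congr 1; rw [hp]; ring
            have h6 : M (k + 1) ω ^ (-η) ≤ 2 :=
              (Real.rpow_le_rpow_of_nonpos hbK h4 (by linarith)).trans hη
            rw [h5, ← ENNReal.ofReal_ofNat 2, ← ENNReal.ofReal_mul (by norm_num)]
            exact ENNReal.ofReal_le_ofReal
              (mul_le_mul_of_nonneg_right h6 (Real.rpow_nonneg (h1 _).le _))
        _ = 2 * ∫⁻ ω in A (k + 1), ENNReal.ofReal (M (k + 1) ω ^ (-ε)) ∂μ :=
            lintegral_const_mul _ ((hMm _).pow_const _).ennreal_ofReal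
        _ ≤ _ := by
            refine mul_le_mul' le_rfl ?_
            exact aux_jensen hmart hnonneg hMinf hconv hpos (hc (k + 1)) (hcM (k + 1)) hε (hAm _)
    have hsum : ∀ n : ℕ, ∑ k ∈ Finset.range n,
        ∫⁻ ω in A k, ENNReal.ofReal (M k ω ^ (-p)) ∂μ ≤ 2⁻¹ := by
      intro n
      calc ∑ k ∈ Finset.range n, ∫⁻ ω in A k, ENNReal.ofReal (M k ω ^ (-p)) ∂μ
          ≤ ∑ k ∈ Finset.range n, 2 * ∫⁻ ω in A k, ENNReal.ofReal (Minf ω ^ (-ε)) ∂μ :=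
            Finset.sum_le_sum fun k _ => hover k
        _ = 2 * ∫⁻ ω in ⋃ k ∈ Finset.range n, A k, ENNReal.ofReal (Minf ω ^ (-ε)) ∂μ := by
            rw [← Finset.mul_sum, lintegral_biUnion_finset (hAdisj _) fun k _ => hAm0 k]
        _ ≤ 2 * ∫⁻ ω in B j, ENNReal.ofReal (Minf ω ^ (-ε)) ∂μ := by
            refine mul_le_mul' le_rfl (lintegral_mono_set ?_)
            refine Set.iUnion₂_subset fun k _ ω hω => ⟨k, hω.1⟩
        _ ≤ 2 * (1 / 4) := mul_le_mul' le_rfl hj.le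
        _ = 2⁻¹ := by
            rw [one_div, show (4 : ENNReal) = 2 * 2 by norm_num,
              ENNReal.mul_inv (by simp) (by simp), ← mul_assoc,
              ENNReal.mul_inv_cancel (by simp) (by simp), one_mul]
    have hbound : ∀ n, ∫⁻ ω, ENNReal.ofReal (M n ω ^ (-p)) ∂μ ≤ 2 * ENNReal.ofReal (b ^ (-p)) := by
      intro n
      induction n using Nat.strong_induction_on with
      | _ n ih =>
      calc ∫⁻ ω, ENNReal.ofReal (M n ω ^ (-p)) ∂μ
          ≤ ∫⁻ ω, (ENNReal.ofReal (b ^ (-p)) + ∑ k ∈ Finset.range (n + 1),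
              (A k).indicator (fun ω => ENNReal.ofReal (M n ω ^ (-p))) ω) ∂μ := by
            refine lintegral_mono fun ω => ?_
            by_cases hex : ∃ k, k ≤ n ∧ M k ω ≤ b
            · have hspec := Nat.find_spec hex
              have hmem : ω ∈ A (Nat.find hex) := by
                refine ⟨hspec.2, fun i hi => ?_⟩
                have := Nat.find_min hex hi
                by_contra hcon
                exact this ⟨(hi.le.trans hspec.1), not_lt.1 hcon⟩
              refine le_trans ?_ le_add_self
              refine le_trans ?_ (Finset.single_le_sum (fun _ _ => zero_le)
                (Finset.mem_range.2 (Nat.lt_succ_of_le hspec.1)))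
              rw [Set.indicator_of_mem hmem]
            · push Not at hex
              refine le_trans ?_ le_self_add
              exact ENNReal.ofReal_le_ofReal
                (Real.rpow_le_rpow_of_nonpos hb0 (hex n le_rfl).le (by linarith))
        _ = ENNReal.ofReal (b ^ (-p)) + ∑ k ∈ Finset.range (n + 1),
              ∫⁻ ω in A k, ENNReal.ofReal (M n ω ^ (-p)) ∂μ := by
            rw [lintegral_add_left measurable_const, lintegral_finsetSum]
            · simp only [lintegral_const, measure_univ, mul_one]
              congr 1
              exact Finset.sum_congr rfl fun k _ => lintegral_indicator (hAm0 k) _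
            · intro k _
              exact ((hMm n).pow_const _).ennreal_ofReal.indicator (hAm0 k)
        _ ≤ ENNReal.ofReal (b ^ (-p)) + ∑ k ∈ Finset.range (n + 1),
              (∫⁻ ω in A k, ENNReal.ofReal (M k ω ^ (-p)) ∂μ) *
                (2 * ENNReal.ofReal (b ^ (-p))) := by
            refine add_le_add le_rfl (Finset.sum_le_sum fun k hk => ?_)
            rcases Nat.eq_zero_or_pos k with rfl | hk0
            · rw [setLIntegral_measure_zero _ _ hA0]; exact zero_le
            · have hkn : k ≤ n := Nat.lt_succ_iff.1 (Finset.mem_range.1 hk)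
              have h1 := aux_prod hmart hprod hc hcM hp0 k (n - k) (hAm k)
              rw [Nat.add_sub_cancel' hkn] at h1
              exact h1.trans (mul_le_mul' le_rfl (ih (n - k) (by omega)))
        _ ≤ ENNReal.ofReal (b ^ (-p)) + 2⁻¹ * (2 * ENNReal.ofReal (b ^ (-p))) := by
            rw [← Finset.sum_mul]
            exact add_le_add le_rfl (mul_le_mul' (hsum _) le_rfl)
        _ = 2 * ENNReal.ofReal (b ^ (-p)) := by
            rw [← mul_assoc, ENNReal.inv_mul_cancel (by simp) (by simp), one_mul, two_mul]
    exact lt_of_le_of_lt (iSup_le hbound)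
      (ENNReal.mul_lt_top (by simp) ENNReal.ofReal_lt_top)
  rw [isOpen_iff_mem_nhds]
  rintro ε ⟨hε, hfin⟩
  obtain ⟨p, hpε, hpfin⟩ := hup ε hε hfin
  filter_upwards [Ioo_mem_nhds hε hpε] with q hq
  exact ⟨hq.1, hdown q p hq.1 hq.2.le hpfin⟩
end
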